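/- Fix an even integer d ≥ 4 such that 10^(8/d) is irrational, and let n ≥ 2d and m ≥ 2d. Then there exists a choice of parameters W₁ ∈ ℝ^{n×2d}, b₁ ∈ ℝ^n, W₂ ∈ ℝ^{m×n}, b₂ ∈ ℝ^m such that the positional–interaction encoder Enc_PI(a,b) = MLP([p_a ‖ p_b]) simultaneously satisfies: (1) Enc_PI is injective on ℕ_{>0} × ℕ_{>0}; (2) there is a compact set K ⊆ ℝ^m containing Enc_PI(a,b) for all positive integers a, b; and (3) there is a constant L > 0 with ‖Enc_PI(a,b) − Enc_PI(a',b')‖₂ ≤ L(|a − a'| + |b − b'|) for all real a, b, a', b'. -/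

import Mathlib

/-- The frequency `ω_i = 10000 ^ (-2 i / d)`. -/
noncomputable def omegaFreq (d i : ℕ) : ℝ :=
  (10000 : ℝ) ^ (-(2 * (i : ℝ)) / (d : ℝ))

/-- Sinusoidal positional encoding `p : ℝ → ℝ^d`, with
`(p_a)_{2i} = sin(ω_i a)` and `(p_a)_{2i+1} = cos(ω_i a)`. -/
noncomputable def posEnc (d : ℕ) (a : ℝ) : EuclideanSpace ℝ (Fin d) :=
  (WithLp.equiv 2 (Fin d → ℝ)).symm fun j =>
    if j.val % 2 = 0 then Real.sin (omegaFreq d (j.val / 2) * a)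
    else Real.cos (omegaFreq d (j.val / 2) * a)


/-- Concatenated encoding `E(a,b) = [p_a ‖ p_b] ∈ ℝ^{2d}`. -/
noncomputable def concatEnc (d : ℕ) (a b : ℝ) : EuclideanSpace ℝ (Fin (2 * d)) :=
  (WithLp.equiv 2 (Fin (2 * d) → ℝ)).symm fun j =>
    if h : j.val < d then WithLp.equiv 2 (Fin d → ℝ) (posEnc d a) ⟨j.val, h⟩
    else WithLp.equiv 2 (Fin d → ℝ) (posEnc d b) ⟨j.val - d, by have := j.isLt; omega⟩


/-- Two-layer ReLU network `MLP(x) = W₂ σ(W₁ x + b₁) + b₂`, where `σ` is the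
componentwise ReLU `σ(t)_j = max(t_j, 0)`. -/
noncomputable def mlp {dIn n m : ℕ}
    (W₁ : Matrix (Fin n) (Fin dIn) ℝ) (b₁ : Fin n → ℝ)
    (W₂ : Matrix (Fin m) (Fin n) ℝ) (b₂ : Fin m → ℝ)
    (x : EuclideanSpace ℝ (Fin dIn)) : EuclideanSpace ℝ (Fin m) :=
  (WithLp.equiv 2 (Fin m → ℝ)).symm
    (W₂.mulVec (fun j => max ((W₁.mulVec (WithLp.equiv 2 (Fin dIn → ℝ) x) + b₁) j) 0) + b₂)


/-- The positional–interaction encoder `Enc_PI(a,b) = MLP([p_a ‖ p_b])`. -/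
noncomputable def encPI (d n m : ℕ)
    (W₁ : Matrix (Fin n) (Fin (2 * d)) ℝ) (b₁ : Fin n → ℝ)
    (W₂ : Matrix (Fin m) (Fin n) ℝ) (b₂ : Fin m → ℝ)
    (a b : ℝ) : EuclideanSpace ℝ (Fin m) :=
  mlp W₁ b₁ W₂ b₂ (concatEnc d a b)

/-- The inclusion matrix `ℝ^k → ℝ^n` (or projection) with ones on the main diagonal. -/
def diagEmbedding (n k : ℕ) : Matrix (Fin n) (Fin k) ℝ :=
  Matrix.of fun i j => if i.val = j.val then 1 else 0

theorem diagEmbedding_mulVec_apply {n k : ℕ} (x : Fin k → ℝ) (i : Fin n) :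
    (diagEmbedding n k).mulVec x i = if h : i.val < k then x ⟨i.val, h⟩ else 0 := by
  simp only [diagEmbedding, Matrix.mulVec, dotProduct, Matrix.of_apply, ite_mul, one_mul, zero_mul]
  split_ifs with h
  · rw [Finset.sum_eq_single_of_mem ⟨i.val, h⟩ (Finset.mem_univ _)]
    · simp
    · intro j _ hj
      exact if_neg fun hij => hj (Fin.ext hij.symm)
  · exact Finset.sum_eq_zero fun j _ => if_neg fun hij => h (hij.trans_lt j.isLt)

theorem omegaFreq_zero (d : ℕ) : omegaFreq d 0 = 1 := by
  simp [omegaFreq]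

theorem omegaFreq_pos (d i : ℕ) : 0 < omegaFreq d i :=
  Real.rpow_pos_of_pos (by norm_num) _

theorem omegaFreq_le_one (d i : ℕ) : omegaFreq d i ≤ 1 :=
  Real.rpow_le_one_of_one_le_of_nonpos (by norm_num)
    (div_nonpos_of_nonpos_of_nonneg (by simp) (by positivity))

theorem posEnc_apply (d : ℕ) (a : ℝ) (j : Fin d) :
    posEnc d a j = if j.val % 2 = 0 then Real.sin (omegaFreq d (j.val / 2) * a)
      else Real.cos (omegaFreq d (j.val / 2) * a) := rfl

theorem concatEnc_apply (d : ℕ) (a b : ℝ) (j : Fin (2 * d)) :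
    concatEnc d a b j = if h : j.val < d then posEnc d a ⟨j.val, h⟩
      else posEnc d b ⟨j.val - d, by omega⟩ := rfl

theorem abs_posEnc_apply_le_one (d : ℕ) (a : ℝ) (j : Fin d) : |posEnc d a j| ≤ 1 := by
  rw [posEnc_apply]
  split_ifs
  exacts [Real.abs_sin_le_one _, Real.abs_cos_le_one _]

theorem abs_posEnc_apply_sub_le (d : ℕ) (a a' : ℝ) (j : Fin d) :
    |posEnc d a j - posEnc d a' j| ≤ |a - a'| := by
  have hω : |omegaFreq d (j.val / 2) * a - omegaFreq d (j.val / 2) * a'| ≤ |a - a'| := by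
    rw [← mul_sub, abs_mul, abs_of_pos (omegaFreq_pos _ _)]
    exact mul_le_of_le_one_left (abs_nonneg _) (omegaFreq_le_one _ _)
  rw [posEnc_apply, posEnc_apply]
  split_ifs
  exacts [(Real.abs_sin_sub_sin_le _ _).trans hω, (Real.abs_cos_sub_cos_le _ _).trans hω]

theorem abs_concatEnc_apply_le_one (d : ℕ) (a b : ℝ) (j : Fin (2 * d)) :
    |concatEnc d a b j| ≤ 1 := by
  rw [concatEnc_apply]
  split_ifs <;> exact abs_posEnc_apply_le_one _ _ _

theorem abs_concatEnc_apply_sub_le (d : ℕ) (a b a' b' : ℝ) (j : Fin (2 * d)) :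
    |concatEnc d a b j - concatEnc d a' b' j| ≤ |a - a'| + |b - b'| := by
  rw [concatEnc_apply, concatEnc_apply]
  split_ifs
  · exact (abs_posEnc_apply_sub_le _ _ _ _).trans (le_add_of_nonneg_right (abs_nonneg _))
  · exact (abs_posEnc_apply_sub_le _ _ _ _).trans (le_add_of_nonneg_left (abs_nonneg _))

theorem Nat.eq_of_sin_eq_of_cos_eq {a b : ℕ} (hsin : Real.sin a = Real.sin b)
    (hcos : Real.cos a = Real.cos b) : a = b := by
  obtain ⟨k, hk⟩ :=
    Real.Angle.angle_eq_iff_two_pi_dvd_sub.1 (Real.Angle.cos_sin_inj hcos hsin)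
  by_cases hk0 : k = 0
  · rw [hk0, Int.cast_zero, mul_zero, sub_eq_zero] at hk
    exact_mod_cast hk
  · refine absurd irrational_pi (not_not.2 ⟨((a : ℚ) - b) / (2 * k), ?_⟩)
    have : (k : ℝ) ≠ 0 := by exact_mod_cast hk0
    push_cast
    rw [hk]
    field_simp

theorem posEnc_natCast_injective {d : ℕ} (hd : 2 ≤ d) :
    Function.Injective fun a : ℕ => posEnc d a := by
  intro a b h
  have hcoord (j : Fin d) : posEnc d a j = posEnc d b j := congrArg (fun v => v j) h
  apply Nat.eq_of_sin_eq_of_cos_eq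
  · simpa [posEnc_apply, omegaFreq_zero] using hcoord ⟨0, by omega⟩
  · simpa [posEnc_apply, omegaFreq_zero] using hcoord ⟨1, by omega⟩

theorem posEnc_eq_of_concatEnc_eq {d : ℕ} {a b a' b' : ℝ}
    (h : concatEnc d a b = concatEnc d a' b') :
    posEnc d a = posEnc d a' ∧ posEnc d b = posEnc d b' := by
  have hcoord (j : Fin (2 * d)) : concatEnc d a b j = concatEnc d a' b' j :=
    congrArg (fun v => v j) h
  constructor <;> ext j
  · simpa [concatEnc_apply] using hcoord ⟨j.val, by omega⟩
  · simpa [concatEnc_apply] using hcoord ⟨d + j.val, by omega⟩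

/-- With diagonal weights and unit bias, the network returns the encoding shifted by one and padded
with constants. -/
theorem encPI_diagEmbedding_apply {d n m : ℕ} (hn : 2 * d ≤ n) (a b : ℝ) (i : Fin m) :
    encPI d n m (diagEmbedding n (2 * d)) 1 (diagEmbedding m n) 0 a b i =
      if h : i.val < 2 * d then concatEnc d a b ⟨i.val, h⟩ + 1
      else if i.val < n then 1 else 0 := by
  change ((diagEmbedding m n).mulVec (fun j =>
    max (((diagEmbedding n (2 * d)).mulVec (fun k => concatEnc d a b k) + 1) j) 0) + 0) i = _
  rw [add_zero, diagEmbedding_mulVec_apply]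
  simp only [Pi.add_apply, Pi.one_apply, diagEmbedding_mulVec_apply]
  split_ifs with hin hid hid
  · have := abs_le.1 (abs_concatEnc_apply_le_one d a b ⟨i.val, hid⟩)
    exact max_eq_left (by linarith)
  · simp
  · omega
  · rfl

theorem EuclideanSpace.norm_le_card_mul {ι : Type*} [Fintype ι] {C : ℝ}
    {x : EuclideanSpace ℝ ι} (hx : ∀ i, |x i| ≤ C) : ‖x‖ ≤ Fintype.card ι * C := by
  classical
  calc ‖x‖ = ‖∑ i, EuclideanSpace.single i (x i)‖ := by
        congr 1
        ext j
        simp [Pi.single_apply]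
    _ ≤ ∑ i, ‖EuclideanSpace.single i (x i)‖ := norm_sum_le _ _
    _ ≤ ∑ _i : ι, C := Finset.sum_le_sum fun i _ => by simpa using hx i
    _ = Fintype.card ι * C := by simp

/-- The paper's theorem on the positional–interaction encoder: for an even integer
`d ≥ 4` with `10 ^ (8/d)` irrational and widths `n, m ≥ 2d`, there are parameters
such that `Enc_PI(a,b) = MLP([p_a ‖ p_b])` is (1) injective on pairs of positive
integers, (2) has all its values on positive integers inside a compact set
`K ⊆ ℝ^m`, and (3) is Lipschitz: there is `L > 0` with
`‖Enc_PI(a,b) − Enc_PI(a',b')‖₂ ≤ L (|a − a'| + |b − b'|)` for all reals. -/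
theorem encPI_injective_bounded_lipschitz
    (d n m : ℕ) (heven : Even d) (hd : 4 ≤ d)
    (hirr : Irrational ((10 : ℝ) ^ ((8 : ℝ) / (d : ℝ))))
    (hn : 2 * d ≤ n) (hm : 2 * d ≤ m) :
    ∃ (W₁ : Matrix (Fin n) (Fin (2 * d)) ℝ) (b₁ : Fin n → ℝ)
      (W₂ : Matrix (Fin m) (Fin n) ℝ) (b₂ : Fin m → ℝ),
      (∀ a b a' b' : ℕ, 0 < a → 0 < b → 0 < a' → 0 < b' →
        (a, b) ≠ (a', b') →
        encPI d n m W₁ b₁ W₂ b₂ (a : ℝ) (b : ℝ) ≠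
          encPI d n m W₁ b₁ W₂ b₂ (a' : ℝ) (b' : ℝ)) ∧
      (∃ K : Set (EuclideanSpace ℝ (Fin m)),
        IsCompact K ∧
        ∀ a b : ℕ, 0 < a → 0 < b →
          encPI d n m W₁ b₁ W₂ b₂ (a : ℝ) (b : ℝ) ∈ K) ∧
      (∃ L : ℝ, 0 < L ∧
        ∀ a b a' b' : ℝ,
          ‖encPI d n m W₁ b₁ W₂ b₂ a b - encPI d n m W₁ b₁ W₂ b₂ a' b'‖ ≤
            L * (|a - a'| + |b - b'|)) := by
  refine ⟨diagEmbedding n (2 * d), 1, diagEmbedding m n, 0, ?_, ?_, ?_⟩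
  · intro a b a' b' _ _ _ _ hne heq
    have hE : concatEnc d a b = concatEnc d a' b' := by
      ext j
      have hj := congrArg (fun v => v (⟨j.val, by omega⟩ : Fin m)) heq
      simpa only [encPI_diagEmbedding_apply hn, j.isLt, dite_true, add_left_inj] using hj
    obtain ⟨ha, hb⟩ := posEnc_eq_of_concatEnc_eq hE
    exact hne (Prod.ext (posEnc_natCast_injective (by omega) ha)
      (posEnc_natCast_injective (by omega) hb))
  · refine ⟨Metric.closedBall 0 (m * 2), isCompact_closedBall _ _, fun a b _ _ => ?_⟩
    rw [mem_closedBall_zero_iff]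
    refine (EuclideanSpace.norm_le_card_mul fun i => ?_).trans_eq
      (by rw [Fintype.card_fin])
    rw [encPI_diagEmbedding_apply hn]
    split_ifs with h _
    · have := abs_le.1 (abs_concatEnc_apply_le_one d a b ⟨i.val, h⟩)
      exact abs_le.2 ⟨by linarith, by linarith⟩
    · norm_num
    · norm_num
  · refine ⟨m, by exact_mod_cast (by omega : 0 < m), fun a b a' b' => ?_⟩
    refine (EuclideanSpace.norm_le_card_mul fun i => ?_).trans_eq
      (by rw [Fintype.card_fin])
    rw [PiLp.sub_apply, encPI_diagEmbedding_apply hn, encPI_diagEmbedding_apply hn]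
    split_ifs with h _
    · rw [add_sub_add_right_eq_sub]
      exact abs_concatEnc_apply_sub_le d a b a' b' _
    all_goals rw [sub_self, abs_zero]; positivity
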